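/- arXiv:alg-geom/9610004 — 5 statements merged into one kernel-verified Lean document; each statement's English description precedes it below -/
import Mathlib

section
/- Let α₁, …, αₙ be r×r complex matrices such that [αᵢ, αⱼ] = 0 for all i, j and such that Σ_{i=1}^n [αᵢ*, αᵢ] = 0. Then every αⱼ is normal, i.e. [αⱼ*, αⱼ] = 0 for each j. -/
open Matrix

open scoped ComplexOrder in
theorem aux_trace {r : ℕ} (A B : Matrix (Fin r) (Fin r) ℂ) (h : A * B = B * A) :
    ((Aᴴ * A - A * Aᴴ) * (Bᴴ * B - B * Bᴴ)).trace
      = ((A * Bᴴ - Bᴴ * A)ᴴ * (A * Bᴴ - Bᴴ * A)).trace := by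
  have e1 : (B * Aᴴ * (A * Bᴴ)).trace = (Aᴴ * A * (Bᴴ * B)).trace := by
    rw [Matrix.mul_assoc, Matrix.trace_mul_comm]; simp only [Matrix.mul_assoc]
  have e2 : (B * Aᴴ * (Bᴴ * A)).trace = (A * Aᴴ * (Bᴴ * B)).trace := by
    calc _ = ((B * Aᴴ * Bᴴ) * A).trace := by simp only [Matrix.mul_assoc]
      _ = (A * (B * Aᴴ * Bᴴ)).trace := Matrix.trace_mul_comm _ _
      _ = ((A * B) * (Aᴴ * Bᴴ)).trace := by simp only [Matrix.mul_assoc]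
      _ = (B * (A * Aᴴ * Bᴴ)).trace := by rw [h]; simp only [Matrix.mul_assoc]
      _ = ((A * Aᴴ * Bᴴ) * B).trace := Matrix.trace_mul_comm _ _
      _ = _ := by simp only [Matrix.mul_assoc]
  have e3 : (Aᴴ * B * (A * Bᴴ)).trace = (Aᴴ * A * (B * Bᴴ)).trace := by
    have : Aᴴ * B * (A * Bᴴ) = Aᴴ * (B * A) * Bᴴ := by simp only [Matrix.mul_assoc]
    rw [this, ← h]; simp only [Matrix.mul_assoc]
  have e4 : (Aᴴ * B * (Bᴴ * A)).trace = (A * Aᴴ * (B * Bᴴ)).trace := by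
    rw [← Matrix.mul_assoc, Matrix.trace_mul_comm]; simp only [Matrix.mul_assoc]
  simp only [conjTranspose_sub, conjTranspose_mul, conjTranspose_conjTranspose,
    Matrix.sub_mul, Matrix.mul_sub, trace_sub, e1, e2, e3, e4]
  ring

open scoped ComplexOrder in
/-- If `α₁, …, αₙ` are `r × r` complex matrices with `[αᵢ, αⱼ] = 0` for all `i, j` and
`∑ i, [αᵢ*, αᵢ] = 0`, then each `αⱼ` is normal, i.e. `[αⱼ*, αⱼ] = 0`. -/
theorem normal_of_commuting_and_zero_moment (n r : ℕ)
    (α : Fin n → Matrix (Fin r) (Fin r) ℂ)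
    (hcomm : ∀ i j, α i * α j = α j * α i)
    (hmom : ∑ i, ((α i)ᴴ * α i - α i * (α i)ᴴ) = 0) :
    ∀ j, (α j)ᴴ * α j = α j * (α j)ᴴ := by
  intro j
  have hs : ∑ i, ((α i * (α j)ᴴ - (α j)ᴴ * α i)ᴴ * (α i * (α j)ᴴ - (α j)ᴴ * α i)).trace = 0 := by
    rw [← Finset.sum_congr rfl (fun i _ => aux_trace (α i) (α j) (hcomm i j)),
      ← trace_sum, ← Finset.sum_mul, hmom, Matrix.zero_mul, trace_zero]
  have h := (Finset.sum_eq_zero_iff_of_nonneg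
    (fun i _ => (posSemidef_conjTranspose_mul_self _).trace_nonneg)).1 hs j (Finset.mem_univ j)
  rw [trace_conjTranspose_mul_self_eq_zero_iff] at h
  exact (sub_eq_zero.1 h).symm
end

section
/- The map sending an r-tuple (λ⁽¹⁾, …, λ⁽ʳ⁾) of points of ℂⁿ to the n-tuple of diagonal matrices (diag(λ⁽¹⁾₁, …, λ⁽ʳ⁾₁), …, diag(λ⁽¹⁾ₙ, …, λ⁽ʳ⁾ₙ)) induces a bijection from the quotient of (ℂⁿ)ʳ by the action of the symmetric group S_r permuting the r points onto the set of orbits, under simultaneous conjugation by the unitary group U(r), of the set {(α₁, …, αₙ) ∈ Mat_r(ℂ)ⁿ : [αᵢ, αⱼ] = 0 for all i, j and Σ_{i=1}^n [αᵢ*, αᵢ] = 0}. -/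
open Matrix

/-- The `n`-tuple of diagonal matrices associated to an `r`-tuple of points of `ℂⁿ`:
the `i`-th matrix is `diag (λ⁽¹⁾ᵢ, …, λ⁽ʳ⁾ᵢ)`. -/
def diagTuple {n r : ℕ} (lam : Fin r → Fin n → ℂ) : Fin n → Matrix (Fin r) (Fin r) ℂ :=
  fun i => Matrix.diagonal fun p => lam p i

/-- An `n`-tuple of `r × r` matrices is *good* if its components pairwise commute and
`∑ i, [αᵢ*, αᵢ] = 0`. -/
def IsGood {n r : ℕ} (α : Fin n → Matrix (Fin r) (Fin r) ℂ) : Prop :=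
  (∀ i j, α i * α j = α j * α i) ∧ ∑ i, ((α i)ᴴ * α i - α i * (α i)ᴴ) = 0

/-- Two `r`-tuples of points of `ℂⁿ` are related if they differ by a permutation of the
`r` points. -/
def permRel {n r : ℕ} (lam mu : Fin r → Fin n → ℂ) : Prop :=
  ∃ σ : Equiv.Perm (Fin r), mu = lam ∘ σ

/-- Two good `n`-tuples of matrices are related if they differ by simultaneous conjugation
by a unitary matrix. -/
def unitRel {n r : ℕ} (a b : {α : Fin n → Matrix (Fin r) (Fin r) ℂ // IsGood α}) : Prop :=
  ∃ g : Matrix (Fin r) (Fin r) ℂ, g ∈ Matrix.unitaryGroup (Fin r) ℂ ∧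
    ∀ i, b.1 i = g * a.1 i * gᴴ

section helpers

open Module

variable {V : Type*} [NormedAddCommGroup V] [InnerProductSpace ℂ V] [FiniteDimensional ℂ V]

theorem aux_joint {n : ℕ} (T : Fin n → V →ₗ[ℂ] V) (hc : ∀ i j, T i * T j = T j * T i)
    (s : Finset (Fin n)) (W : Submodule ℂ V) (hW : W ≠ ⊥) (hinv : ∀ i, ∀ w ∈ W, T i w ∈ W) :
    ∃ W' : Submodule ℂ V, W' ≤ W ∧ W' ≠ ⊥ ∧ (∀ i, ∀ w ∈ W', T i w ∈ W') ∧
      ∀ i ∈ s, ∃ c : ℂ, ∀ w ∈ W', T i w = c • w := by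
  classical
  induction s using Finset.induction_on with
  | empty => exact ⟨W, le_rfl, hW, hinv, by simp⟩
  | insert j s hj ih =>
    obtain ⟨W', hle, hne, hin, hsc⟩ := ih
    have : Nontrivial W' := Submodule.nontrivial_iff_ne_bot.mpr hne
    obtain ⟨c, hcv⟩ := Module.End.exists_eigenvalue ((T j).restrict (hin j))
    obtain ⟨v, hv⟩ := hcv.exists_hasEigenvector
    have hv1 := hv.apply_eq_smul
    have hv0 := hv.2
    refine ⟨W' ⊓ Module.End.eigenspace (T j) c, inf_le_left.trans hle, ?_, ?_, ?_⟩
    · intro h0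
      apply hv0
      have hm : (v : V) ∈ W' ⊓ Module.End.eigenspace (T j) c := by
        refine ⟨v.2, ?_⟩
        apply Module.End.mem_eigenspace_iff.mpr
        have := congrArg Subtype.val hv1
        simpa using this
      rw [h0, Submodule.mem_bot] at hm
      exact Subtype.ext hm
    · rintro i w ⟨h1, h2⟩
      refine ⟨hin i w h1, ?_⟩
      have h2' := Module.End.mem_eigenspace_iff.mp h2
      apply Module.End.mem_eigenspace_iff.mpr
      have := congrArg (fun f => f w) (hc j i)
      simp only [Module.End.mul_apply] at this
      rw [this, h2', map_smul]
    · intro i hi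
      rcases Finset.mem_insert.mp hi with rfl | hi
      · exact ⟨c, fun w hw => Module.End.mem_eigenspace_iff.mp hw.2⟩
      · obtain ⟨d, hd⟩ := hsc i hi
        exact ⟨d, fun w hw => hd w hw.1⟩

theorem aux_adj {n : ℕ} (T : Fin n → V →ₗ[ℂ] V)
    (hs : ∑ i, (LinearMap.adjoint (T i) * T i - T i * LinearMap.adjoint (T i)) = 0)
    (v : V) (m : Fin n → ℂ) (hv : ∀ i, T i v = m i • v) (i : Fin n) :
    LinearMap.adjoint (T i) v = star (m i) • v := by
  have key : ∀ i, inner ℂ v ((LinearMap.adjoint (T i) * T i - T i * LinearMap.adjoint (T i)) v)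
      = -((‖LinearMap.adjoint (T i) v - star (m i) • v‖ ^ 2 : ℝ) : ℂ) := by
    intro i
    have e := inner_self_eq_norm_sq_to_K (𝕜 := ℂ) (LinearMap.adjoint (T i) v - star (m i) • v)
    simp only [Complex.coe_algebraMap] at e
    push_cast
    rw [← e]
    have f1 : inner ℂ v (LinearMap.adjoint (T i) (T i v)) = star (m i) * m i * inner ℂ v v := by
      rw [LinearMap.adjoint_inner_right, hv, inner_smul_left, inner_smul_right]
      simp [mul_assoc]
    have f2 : inner ℂ v (T i (LinearMap.adjoint (T i) v)) =
        inner ℂ (LinearMap.adjoint (T i) v) (LinearMap.adjoint (T i) v) := by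
      rw [LinearMap.adjoint_inner_left (T i)]
    have f3 : inner ℂ (LinearMap.adjoint (T i) v) v = m i * inner ℂ v v := by
      rw [LinearMap.adjoint_inner_left, hv, inner_smul_right]
    have f4 : inner ℂ v (LinearMap.adjoint (T i) v) = star (m i) * inner ℂ v v := by
      rw [LinearMap.adjoint_inner_right, hv, inner_smul_left]
      simp
    rw [LinearMap.sub_apply, Module.End.mul_apply, Module.End.mul_apply, inner_sub_right, f1, f2,
      inner_sub_left, inner_sub_right, inner_sub_right]
    simp only [inner_smul_left, inner_smul_right, f3, f4, Complex.conj_conj,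
      RCLike.star_def]
    ring
  have h0 := congrArg (fun f : V →ₗ[ℂ] V => inner ℂ v (f v)) hs
  simp only [LinearMap.sum_apply, inner_sum, key, LinearMap.zero_apply, inner_zero_right,
    Finset.sum_neg_distrib, neg_eq_zero] at h0
  have h1 : ∑ i, ‖LinearMap.adjoint (T i) v - star (m i) • v‖ ^ 2 = 0 := by exact_mod_cast h0
  have h2 := (Finset.sum_eq_zero_iff_of_nonneg (fun i _ => sq_nonneg _)).mp h1 i (Finset.mem_univ i)
  exact sub_eq_zero.mp (norm_eq_zero.mp (pow_eq_zero_iff (two_ne_zero) |>.mp h2))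

theorem aux_basis {n : ℕ} (T : Fin n → V →ₗ[ℂ] V) (hc : ∀ i j, T i * T j = T j * T i)
    (hs : ∑ i, (LinearMap.adjoint (T i) * T i - T i * LinearMap.adjoint (T i)) = 0)
    (k : ℕ) (hk : k ≤ finrank ℂ V) :
    ∃ (v : Fin k → V) (m : Fin k → Fin n → ℂ), Orthonormal ℂ v ∧ ∀ p i, T i (v p) = m p i • v p := by
  induction k with
  | zero => exact ⟨Fin.elim0, Fin.elim0, ⟨fun i => i.elim0, fun i => i.elim0⟩, fun p => p.elim0⟩
  | succ k ih =>
    obtain ⟨v, m, ho, hv⟩ := ih (by omega)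
    have hW : (Submodule.span ℂ (Set.range v))ᗮ ≠ ⊥ := by
      intro h
      rw [Submodule.orthogonal_eq_bot_iff] at h
      have h1 := finrank_span_eq_card ho.linearIndependent
      rw [h, finrank_top, Fintype.card_fin] at h1
      omega
    have hmem : ∀ w, w ∈ (Submodule.span ℂ (Set.range v))ᗮ ↔ ∀ p, inner ℂ (v p) w = 0 := by
      intro w
      constructor
      · intro h p
        exact (Submodule.mem_orthogonal _ _).mp h _ (Submodule.subset_span ⟨p, rfl⟩)
      · intro h
        rw [Submodule.mem_orthogonal]
        intro u hu
        induction hu using Submodule.span_induction with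
        | mem x hx => obtain ⟨p, rfl⟩ := hx; exact h p
        | zero => simp
        | add x y _ _ hx hy => rw [inner_add_left, hx, hy, add_zero]
        | smul a x _ hx => rw [inner_smul_left, hx, mul_zero]
    obtain ⟨W', hle, hne, hin, hsc⟩ := aux_joint T hc Finset.univ _ hW (by
      intro i w hw
      rw [hmem] at hw ⊢
      intro p
      rw [← LinearMap.adjoint_inner_left, aux_adj T hs (v p) (m p) (hv p) i, inner_smul_left, hw p,
        mul_zero])
    obtain ⟨w, hw, hw0⟩ := (Submodule.ne_bot_iff _).mp hne
    choose c hcc using fun i => hsc i (Finset.mem_univ i)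
    have hwn : (‖w‖ : ℂ) ≠ 0 := by simpa using hw0
    let u : V := (‖w‖ : ℂ)⁻¹ • w
    have hu : u ∈ W' := W'.smul_mem _ hw
    have hu1 : ‖u‖ = 1 := by
      simp only [u, norm_smul, norm_inv, Complex.norm_real, norm_norm]
      exact inv_mul_cancel₀ (norm_ne_zero_iff.mpr hw0)
    have huo := (hmem u).mp (hle hu)
    refine ⟨Fin.cons u v, Fin.cons c m, ⟨?_, ?_⟩, ?_⟩
    · intro p
      refine Fin.cases ?_ (fun p => ?_) p
      · simpa using hu1
      · simpa using ho.1 p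
    · intro p q
      refine Fin.cases ?_ (fun p => ?_) p <;> refine Fin.cases ?_ (fun q => ?_) q
      · simp
      · intro _
        simpa using inner_eq_zero_symm.mp (huo q)
      · intro _
        simpa using huo p
      · intro h
        simpa using ho.2 (fun e => h (by rw [e]))
    · intro p i
      refine Fin.cases ?_ (fun p => ?_) p
      · simpa using hcc i u hu
      · simpa using hv p i

end helpers

theorem aux_good {n r : ℕ} (lam : Fin r → Fin n → ℂ) : IsGood (diagTuple lam) := by
  constructor
  · intro i j
    simp [diagTuple, Matrix.diagonal_mul_diagonal, mul_comm]
  · apply Finset.sum_eq_zero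
    intro i _
    simp [diagTuple, Matrix.diagonal_conjTranspose, Matrix.diagonal_mul_diagonal, mul_comm]

theorem aux_equiv {n r : ℕ} : Equivalence (@unitRel n r) := by
  refine ⟨fun a => ⟨1, one_mem _, by simp⟩, ?_, ?_⟩
  · rintro a b ⟨g, hg, h⟩
    have h1 : gᴴ * g = 1 := Matrix.mem_unitaryGroup_iff'.mp hg
    refine ⟨gᴴ, Unitary.star_mem hg, fun i => ?_⟩
    rw [h i, conjTranspose_conjTranspose]
    calc a.1 i = (gᴴ * g) * a.1 i * (gᴴ * g) := by rw [h1]; simp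
      _ = _ := by simp only [Matrix.mul_assoc]
  · rintro a b c ⟨g, hg, h⟩ ⟨k, hk, h'⟩
    refine ⟨k * g, mul_mem hk hg, fun i => ?_⟩
    rw [h' i, h i, conjTranspose_mul]
    simp only [Matrix.mul_assoc]

theorem aux_inj {n r : ℕ} (lam mu : Fin r → Fin n → ℂ) (g : Matrix (Fin r) (Fin r) ℂ)
    (hg : g ∈ Matrix.unitaryGroup (Fin r) ℂ)
    (h : ∀ i, diagTuple mu i = g * diagTuple lam i * gᴴ) : permRel lam mu := by
  have h1 : gᴴ * g = 1 := Matrix.mem_unitaryGroup_iff'.mp hg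
  have hd : g.det ≠ 0 := by
    intro h0
    have := congrArg Matrix.det h1
    simp [h0] at this
  have h2 : ∀ p q, g p q ≠ 0 → mu p = lam q := by
    intro p q hpq
    funext i
    have e : diagTuple mu i * g = g * diagTuple lam i := by
      rw [h i, Matrix.mul_assoc, h1, Matrix.mul_one]
    have e' := congrFun (congrFun e p) q
    simp only [diagTuple, Matrix.diagonal_mul, Matrix.mul_diagonal] at e'
    rw [mul_comm] at e'
    exact mul_left_cancel₀ hpq e'
  rw [Matrix.det_apply] at hd
  obtain ⟨σ, _, hσ⟩ := Finset.exists_ne_zero_of_sum_ne_zero hd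
  have h3 : ∏ p, g (σ p) p ≠ 0 := fun h0 => hσ (by rw [h0, smul_zero])
  rw [Finset.prod_ne_zero_iff] at h3
  refine ⟨σ.symm, ?_⟩
  funext p
  have := h2 (σ (σ.symm p)) (σ.symm p) (h3 _ (Finset.mem_univ _))
  simpa using this

theorem aux_perm {n r : ℕ} (lam mu : Fin r → Fin n → ℂ) (h : permRel lam mu) :
    unitRel ⟨diagTuple lam, aux_good lam⟩ ⟨diagTuple mu, aux_good mu⟩ := by
  obtain ⟨σ, rfl⟩ := h
  let g : Matrix (Fin r) (Fin r) ℂ := (1 : Matrix (Fin r) (Fin r) ℂ).submatrix σ id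
  have hg : gᴴ = (1 : Matrix (Fin r) (Fin r) ℂ).submatrix id σ := by
    simp [g, Matrix.conjTranspose_submatrix]
  refine ⟨g, ?_, ?_⟩
  · rw [Matrix.mem_unitaryGroup_iff, Matrix.star_eq_conjTranspose, hg]
    ext p q
    simp [g, Matrix.mul_apply, Matrix.one_apply]
  · intro i
    rw [hg]
    ext p q
    simp [g, diagTuple, Matrix.mul_apply, Matrix.one_apply, Matrix.diagonal_apply]
    split_ifs with h
    · rw [h]
    · rfl

theorem aux_surj {n r : ℕ} (a : {α : Fin n → Matrix (Fin r) (Fin r) ℂ // IsGood α}) :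
    ∃ lam, unitRel ⟨diagTuple lam, aux_good lam⟩ a := by
  obtain ⟨α, hc, hs⟩ := a
  let T : Fin n → EuclideanSpace ℂ (Fin r) →ₗ[ℂ] EuclideanSpace ℂ (Fin r) :=
    fun i => Matrix.toEuclideanLin (α i)
  have hmul : ∀ A B : Matrix (Fin r) (Fin r) ℂ,
      Matrix.toEuclideanLin (A * B) = Matrix.toEuclideanLin A * Matrix.toEuclideanLin B := by
    intro A B
    ext x j
    simp [Matrix.toLpLin_apply, Matrix.mulVec_mulVec]
  have hT : ∀ i j, T i * T j = T j * T i := by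
    intro i j
    simp only [T]
    rw [← hmul, hc, hmul]
  have hS : ∑ i, (LinearMap.adjoint (T i) * T i - T i * LinearMap.adjoint (T i)) = 0 := by
    have := congrArg Matrix.toEuclideanLin hs
    rw [map_sum, map_zero] at this
    rw [← this]
    refine Finset.sum_congr rfl fun i _ => ?_
    rw [map_sub, hmul, hmul, Matrix.toEuclideanLin_conjTranspose_eq_adjoint]
  obtain ⟨v, m, ho, hv⟩ := aux_basis T hT hS r (by simp)
  let k : Matrix (Fin r) (Fin r) ℂ := Matrix.of fun q p => v p q
  have hk : kᴴ * k = 1 := by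
    ext p q
    have := orthonormal_iff_ite.mp ho p q
    rw [Matrix.one_apply, ← this]
    simp [k, Matrix.mul_apply, PiLp.inner_apply, mul_comm]
  have hk' : k * kᴴ = 1 := mul_eq_one_comm.mp hk
  refine ⟨m, k, Matrix.mem_unitaryGroup_iff.mpr hk', fun i => ?_⟩
  have e : α i * k = k * diagTuple m i := by
    ext q p
    have := congrArg (fun x : EuclideanSpace ℂ (Fin r) => x q) (hv p i)
    simp only [T, Matrix.toLpLin_apply, Matrix.mulVec, dotProduct, PiLp.smul_apply,
      smul_eq_mul] at this
    have e2 : (k * diagTuple m i) q p = v p q * m p i := by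
      simp only [diagTuple, Matrix.mul_diagonal, k, Matrix.of_apply]
    rw [e2, mul_comm, ← this, Matrix.mul_apply]
    rfl
  change α i = k * diagTuple m i * kᴴ
  rw [← e, Matrix.mul_assoc, hk', Matrix.mul_one]

/-- The map `(λ⁽¹⁾, …, λ⁽ʳ⁾) ↦ (diag (λ⁽ᵖ⁾₁)ₚ, …, diag (λ⁽ᵖ⁾ₙ)ₚ)` induces a bijection from
`(ℂⁿ)ʳ / Sᵣ` onto the set of `U(r)`-conjugation orbits of commuting `n`-tuples of `r × r`
matrices satisfying `∑ i, [αᵢ*, αᵢ] = 0`. -/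
theorem sym_product_equiv_commuting_orbits (n r : ℕ) :
    ∃ (h : ∀ lam : Fin r → Fin n → ℂ, IsGood (diagTuple lam))
      (f : Quot (@permRel n r) → Quot (@unitRel n r)),
      Function.Bijective f ∧
      ∀ lam : Fin r → Fin n → ℂ,
        f (Quot.mk _ lam) = Quot.mk _ ⟨diagTuple lam, h lam⟩ := by
  refine ⟨aux_good, Quot.lift (fun lam => Quot.mk _ ⟨diagTuple lam, aux_good lam⟩)
    (fun a b hab => Quot.sound (aux_perm a b hab)), ⟨?_, ?_⟩, fun lam => rfl⟩
  · rintro ⟨a⟩ ⟨b⟩ hab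
    obtain ⟨g, hg, h⟩ := (aux_equiv.quot_mk_eq_iff _ _).mp hab
    exact Quot.sound (aux_inj a b g hg h)
  · rintro ⟨a⟩
    obtain ⟨lam, h⟩ := aux_surj a
    exact ⟨Quot.mk _ lam, Quot.sound h⟩
end

section
/- Assume ρ acts freely outside the origin. Let α = (α₁, …, αₙ) be a Γ-equivariant, commuting n-tuple of endomorphisms of ℂ^Γ satisfying the zero-moment condition, and suppose α ≠ 0 (some αᵢ is nonzero). Then there exist a unit vector v ∈ ℂ^Γ and a nonzero λ ∈ ℂⁿ such that the family (φ(γ)v)_{γ∈Γ} is an orthonormal basis of ℂ^Γ, αᵢ(φ(γ)v) = (ρ(γ)λ)ᵢ · φ(γ)v for all i and all γ ∈ Γ, and the r eigenvalue n-tuples ρ(γ)λ ∈ ℂⁿ, γ ∈ Γ, are pairwise distinct and all nonzero. -/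
open Matrix

variable {Γ : Type} [Group Γ] [Fintype Γ] [DecidableEq Γ]

/-- The left regular representation of `Γ` on `ℂ^Γ`, as a matrix: `φ(γ) e_δ = e_{γδ}`. -/
def phi (γ : Γ) : Matrix Γ Γ ℂ :=
  fun a b => if a = γ * b then 1 else 0

/-- `Γ`-equivariance of an `n`-tuple of endomorphisms of `ℂ^Γ`:
`φ(γ)⁻¹ αₖ φ(γ) = ∑ l, ρ(γ)_{kl} α_l` for all `γ` and `k`. -/
def Equivariant (n : ℕ) (ρ : Γ →* Matrix.unitaryGroup (Fin n) ℂ)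
    (α : Fin n → Matrix Γ Γ ℂ) : Prop :=
  ∀ (γ : Γ) (k : Fin n),
    phi γ⁻¹ * α k * phi γ = ∑ l, ((ρ γ : Matrix (Fin n) (Fin n) ℂ) k l) • α l

/-- The components pairwise commute. -/
def CommutingTuple (n : ℕ) (α : Fin n → Matrix Γ Γ ℂ) : Prop :=
  ∀ i j, α i * α j = α j * α i

/-- The zero-moment condition `∑ i, (αᵢ* αᵢ − αᵢ αᵢ*) = 0`. -/
def ZeroMoment (n : ℕ) (α : Fin n → Matrix Γ Γ ℂ) : Prop :=
  ∑ i, ((α i)ᴴ * α i - α i * (α i)ᴴ) = 0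

/-- `ρ` acts freely outside the origin: `ρ(γ)v = v` for some `v ≠ 0` implies `γ = 1`. -/
def FreeOutside (n : ℕ) (ρ : Γ →* Matrix.unitaryGroup (Fin n) ℂ) : Prop :=
  ∀ (γ : Γ) (v : Fin n → ℂ), v ≠ 0 →
    (ρ γ : Matrix (Fin n) (Fin n) ℂ).mulVec v = v → γ = 1

open scoped ComplexOrder

lemma phi_mulVec (γ : Γ) (v : Γ → ℂ) : (phi γ).mulVec v = fun a => v (γ⁻¹ * a) := by
  funext a
  simp only [mulVec, dotProduct, phi]
  rw [Finset.sum_eq_single (γ⁻¹ * a)]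
  · simp
  · intro b _ hb
    have : a ≠ γ * b := by rintro rfl; simp at hb
    simp [this]
  · simp

lemma phi_norm (γ : Γ) (v : Γ → ℂ) :
    star ((phi γ).mulVec v) ⬝ᵥ (phi γ).mulVec v = star v ⬝ᵥ v := by
  rw [phi_mulVec]
  simp only [dotProduct, Pi.star_apply]
  exact Equiv.sum_comp (Equiv.mulLeft γ⁻¹) (fun a => star (v a) * v a)

/-- Joint eigenvector. -/
def JEig (n : ℕ) (α : Fin n → Matrix Γ Γ ℂ) (v : Γ → ℂ) (lam : Fin n → ℂ) : Prop :=
  ∀ i, (α i).mulVec v = lam i • v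

lemma jeig_adj (n : ℕ) (α : Fin n → Matrix Γ Γ ℂ) (hmom : ZeroMoment n α)
    (v : Γ → ℂ) (lam : Fin n → ℂ) (h : JEig n α v lam) (i : Fin n) :
    (α i)ᴴ.mulVec v = star (lam i) • v := by
  have key : ∑ i, star ((α i)ᴴ.mulVec v - star (lam i) • v) ⬝ᵥ
      ((α i)ᴴ.mulVec v - star (lam i) • v) = 0 := by
    have h1 : star v ⬝ᵥ ((∑ i, ((α i)ᴴ * α i - α i * (α i)ᴴ)) *ᵥ v) = 0 := by
      unfold ZeroMoment at hmom
      rw [hmom]; simp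
    rw [Matrix.sum_mulVec, dotProduct_sum] at h1
    rw [← neg_eq_zero, ← h1, ← Finset.sum_neg_distrib]
    refine Finset.sum_congr rfl fun i _ => ?_
    have e1 : star v ᵥ* (α i)ᴴ = star (lam i) • star v := by
      rw [← star_mulVec, h i, star_smul]
    have e2 : star v ⬝ᵥ ((α i)ᴴ *ᵥ v) = star (lam i) * (star v ⬝ᵥ v) := by
      rw [dotProduct_mulVec, e1, smul_dotProduct, smul_eq_mul]
    have e3 : star ((α i)ᴴ *ᵥ v) ⬝ᵥ v = lam i * (star v ⬝ᵥ v) := by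
      rw [star_mulVec, conjTranspose_conjTranspose, ← dotProduct_mulVec, h i, dotProduct_smul,
        smul_eq_mul]
    have e4 : star v ⬝ᵥ (α i *ᵥ ((α i)ᴴ *ᵥ v)) = star ((α i)ᴴ *ᵥ v) ⬝ᵥ ((α i)ᴴ *ᵥ v) := by
      rw [star_mulVec, conjTranspose_conjTranspose, ← dotProduct_mulVec]
    simp only [sub_mulVec, ← mulVec_mulVec, h i, mulVec_smul, dotProduct_sub, star_sub,
      sub_dotProduct, star_smul, star_star, smul_dotProduct, dotProduct_smul, e2, e3, e4]
    simp only [smul_eq_mul]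
    ring
  have h2 := (Finset.sum_eq_zero_iff_of_nonneg
    (fun i _ => dotProduct_star_self_nonneg _)).1 key i (Finset.mem_univ i)
  exact sub_eq_zero.1 (dotProduct_star_self_eq_zero.1 h2)

lemma exists_joint (n : ℕ) (α : Fin n → Matrix Γ Γ ℂ) (hcomm : CommutingTuple n α)
    (P : Submodule ℂ (Γ → ℂ)) (hP : P ≠ ⊥) (hinv : ∀ i, ∀ x ∈ P, (α i).mulVec x ∈ P) :
    ∃ v ∈ P, v ≠ 0 ∧ ∃ lam, JEig n α v lam := by
  have main : ∀ s : Finset (Fin n), ∃ E : Submodule ℂ (Γ → ℂ), E ≤ P ∧ E ≠ ⊥ ∧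
      (∀ i, ∀ x ∈ E, (α i).mulVec x ∈ E) ∧
      ∀ i ∈ s, ∃ μ : ℂ, ∀ x ∈ E, (α i).mulVec x = μ • x := by
    intro s
    induction s using Finset.induction_on with
    | empty => exact ⟨P, le_rfl, hP, hinv, by simp⟩
    | insert a s _ ih =>
      obtain ⟨E, hE, hE0, hEi, hEs⟩ := ih
      have : Nontrivial E := Submodule.nontrivial_iff_ne_bot.2 hE0
      let f : Module.End ℂ E := ((α a).mulVecLin).restrict (hEi a)
      obtain ⟨μ, hμ⟩ := Module.End.exists_eigenvalue f
      obtain ⟨w, hw⟩ := hμ.exists_hasEigenvector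
      have hw1 : (α a).mulVec w = μ • (w : Γ → ℂ) := congrArg Subtype.val hw.apply_eq_smul
      refine ⟨E ⊓ LinearMap.ker ((α a).mulVecLin - μ • LinearMap.id),
        inf_le_left.trans hE, ?_, ?_, ?_⟩
      · intro hb
        have : (w : Γ → ℂ) ∈ E ⊓ LinearMap.ker ((α a).mulVecLin - μ • LinearMap.id) := by
          refine ⟨w.2, ?_⟩
          simp [hw1]
        rw [hb] at this
        exact hw.2 (Subtype.ext (by simpa using this))
      · rintro i x ⟨hx, hx2⟩
        refine ⟨hEi i x hx, ?_⟩
        have hx3 : (α a).mulVec x = μ • x := by simpa [sub_eq_zero] using hx2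
        simp only [SetLike.mem_coe, LinearMap.mem_ker, LinearMap.sub_apply, mulVecLin_apply,
          LinearMap.smul_apply, LinearMap.id_apply, sub_eq_zero]
        rw [mulVec_mulVec, hcomm a i, ← mulVec_mulVec, hx3, mulVec_smul]
      · intro i hi
        rcases Finset.mem_insert.1 hi with rfl | hi
        · exact ⟨μ, fun x hx => by simpa [sub_eq_zero] using hx.2⟩
        · obtain ⟨ν, hν⟩ := hEs i hi
          exact ⟨ν, fun x hx => hν x hx.1⟩
  obtain ⟨E, hE, hE0, -, hEs⟩ := main Finset.univ
  obtain ⟨v, hv, hv0⟩ := Submodule.exists_mem_ne_zero_of_ne_bot hE0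
  choose μ hμ using fun i => hEs i (Finset.mem_univ i)
  exact ⟨v, hE hv, hv0, μ, fun i => hμ i v hv⟩

lemma exists_joint_ne (n : ℕ) (α : Fin n → Matrix Γ Γ ℂ) (hcomm : CommutingTuple n α)
    (hmom : ZeroMoment n α) (hne : ∃ i, α i ≠ 0) :
    ∃ v lam, v ≠ 0 ∧ lam ≠ 0 ∧ JEig n α v lam := by
  by_contra! hcon
  have hdot : ∀ v lam, JEig n α v lam → ∀ i x,
      star v ⬝ᵥ (α i).mulVec x = lam i * (star v ⬝ᵥ x) := by
    intro v lam h i x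
    have := jeig_adj n α hmom v lam h i
    have e : star v ᵥ* (α i) = lam i • star v := by
      rw [← conjTranspose_conjTranspose (α i), ← star_mulVec, this, star_smul, star_star]
    rw [dotProduct_mulVec, e, smul_dotProduct, smul_eq_mul]
  let P : Submodule ℂ (Γ → ℂ) :=
    { carrier := {x | ∀ v lam, JEig n α v lam → star v ⬝ᵥ x = 0}
      add_mem' := by
        intro a b ha hb v lam h
        rw [dotProduct_add, ha v lam h, hb v lam h, add_zero]
      zero_mem' := by intro v lam _; simp
      smul_mem' := by
        intro c a ha v lam h
        rw [dotProduct_smul, ha v lam h, smul_zero] }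
  have hP : P = ⊥ := by
    by_contra hP
    obtain ⟨v, hv, hv0, lam, hl⟩ := exists_joint n α hcomm P hP (by
      intro i x hx v lam h
      rw [hdot v lam h, hx v lam h, mul_zero])
    exact hv0 (dotProduct_star_self_eq_zero.1 (hv v lam hl))
  obtain ⟨i, hi⟩ := hne
  apply hi
  apply Matrix.ext_of_mulVec_single
  intro j
  have : (α i).mulVec (Pi.single j 1) ∈ P := by
    intro v lam h
    rw [hdot v lam h]
    by_cases hv : v = 0
    · simp [hv]
    · by_cases hl : lam = 0
      · simp [hl]
      · exact absurd h (hcon v lam hv hl)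
  rw [hP, Submodule.mem_bot] at this
  rw [this, zero_mulVec]

lemma jeig_phi (n : ℕ) (ρ : Γ →* Matrix.unitaryGroup (Fin n) ℂ) (α : Fin n → Matrix Γ Γ ℂ)
    (hequiv : Equivariant n ρ α) (v : Γ → ℂ) (lam : Fin n → ℂ) (h : JEig n α v lam) (γ : Γ) :
    JEig n α ((phi γ).mulVec v) ((ρ γ : Matrix (Fin n) (Fin n) ℂ).mulVec lam) := by
  intro k
  have h1 := congrArg (fun M => (phi γ).mulVec (M.mulVec v)) (hequiv γ k)
  simp only [← mulVec_mulVec] at h1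
  have h2 : ∀ x : Γ → ℂ, (phi γ).mulVec ((phi γ⁻¹).mulVec x) = x := by
    intro x; simp [phi_mulVec]
  rw [h2] at h1
  rw [h1, Matrix.sum_mulVec]
  have : ∑ l, ((ρ γ : Matrix (Fin n) (Fin n) ℂ) k l • α l) *ᵥ v =
      ((ρ γ : Matrix (Fin n) (Fin n) ℂ).mulVec lam k) • v := by
    simp only [smul_mulVec, h _, smul_smul, ← Finset.sum_smul]
    rfl
  rw [this, mulVec_smul]

lemma jeig_orth (n : ℕ) (α : Fin n → Matrix Γ Γ ℂ) (hmom : ZeroMoment n α)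
    (v w : Γ → ℂ) (lam mu : Fin n → ℂ) (hv : JEig n α v lam) (hw : JEig n α w mu)
    (hne : lam ≠ mu) : star v ⬝ᵥ w = 0 := by
  obtain ⟨i, hi⟩ := Function.ne_iff.1 hne
  have e : star v ᵥ* (α i) = lam i • star v := by
    rw [← conjTranspose_conjTranspose (α i), ← star_mulVec, jeig_adj n α hmom v lam hv i,
      star_smul, star_star]
  have h1 : star v ⬝ᵥ (α i).mulVec w = lam i * (star v ⬝ᵥ w) := by
    rw [dotProduct_mulVec, e, smul_dotProduct, smul_eq_mul]
  rw [hw i, dotProduct_smul, smul_eq_mul] at h1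
  have h2 : (lam i - mu i) * (star v ⬝ᵥ w) = 0 := by rw [sub_mul, h1, sub_self]
  exact (mul_eq_zero.1 h2).resolve_left (sub_ne_zero.2 hi)

/-- If `ρ` acts freely outside the origin and `α` is a nonzero `Γ`-equivariant, commuting,
zero-moment `n`-tuple, then there are a unit vector `v` and a nonzero `λ ∈ ℂⁿ` such that
`(φ(γ)v)_{γ∈Γ}` is an orthonormal basis of `ℂ^Γ` consisting of simultaneous eigenvectors of
`α`, with eigenvalue `n`-tuples `ρ(γ)λ` pairwise distinct and all nonzero. -/
theorem exists_eigenbasis (n : ℕ) (ρ : Γ →* Matrix.unitaryGroup (Fin n) ℂ)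
    (hfree : FreeOutside n ρ)
    (α : Fin n → Matrix Γ Γ ℂ)
    (hequiv : Equivariant n ρ α) (hcomm : CommutingTuple n α) (hmom : ZeroMoment n α)
    (hne : ∃ i, α i ≠ 0) :
    ∃ (v : Γ → ℂ) (lam : Fin n → ℂ),
      lam ≠ 0 ∧
      (∀ γ δ : Γ,
        dotProduct (star ((phi γ).mulVec v)) ((phi δ).mulVec v) =
          if γ = δ then 1 else 0) ∧
      Submodule.span ℂ (Set.range fun γ : Γ => (phi γ).mulVec v) = ⊤ ∧
      (∀ (γ : Γ) (i : Fin n),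
        (α i).mulVec ((phi γ).mulVec v) =
          ((ρ γ : Matrix (Fin n) (Fin n) ℂ).mulVec lam i) • ((phi γ).mulVec v)) ∧
      Function.Injective (fun γ : Γ => (ρ γ : Matrix (Fin n) (Fin n) ℂ).mulVec lam) ∧
      (∀ γ : Γ, (ρ γ : Matrix (Fin n) (Fin n) ℂ).mulVec lam ≠ 0) := by
  obtain ⟨u, lam, hu, hl, hul⟩ := exists_joint_ne n α hcomm hmom hne
  obtain ⟨v, hv1, hv⟩ : ∃ v, star v ⬝ᵥ v = 1 ∧ JEig n α v lam := by
    have h0 : star u ⬝ᵥ u ≠ 0 := fun h => hu (dotProduct_star_self_eq_zero.1 h)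
    have hnn : 0 ≤ star u ⬝ᵥ u := dotProduct_star_self_nonneg u
    obtain ⟨hre, him⟩ := Complex.nonneg_iff.1 hnn
    set q := star u ⬝ᵥ u with hq
    have hqr : q = ((q.re : ℝ) : ℂ) := Complex.ext rfl (by simp [← him])
    have hre0 : q.re ≠ 0 := fun h => h0 (by rw [hqr, h]; simp)
    refine ⟨(((Real.sqrt q.re)⁻¹ : ℝ) : ℂ) • u, ?_, ?_⟩
    · rw [star_smul, smul_dotProduct, dotProduct_smul, ← hq, hqr]
      simp only [Complex.star_def, Complex.conj_ofReal, smul_eq_mul, Complex.ofReal_re]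
      rw [← Complex.ofReal_mul, ← Complex.ofReal_mul, ← Complex.ofReal_one]
      congr 1
      have hs : Real.sqrt q.re ≠ 0 := (Real.sqrt_ne_zero hre).2 hre0
      have := Real.mul_self_sqrt hre
      field_simp
      nlinarith
    · intro i
      rw [mulVec_smul, hul i, smul_comm]
  have hE := jeig_phi n ρ α hequiv v lam hv
  have hinv : ∀ γ : Γ, (ρ γ⁻¹ : Matrix (Fin n) (Fin n) ℂ) * (ρ γ : Matrix (Fin n) (Fin n) ℂ) = 1 := by
    intro γ
    have : ρ γ⁻¹ * ρ γ = 1 := by rw [← map_mul]; simp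
    exact congrArg Subtype.val this
  have hinj : Function.Injective (fun γ : Γ => (ρ γ : Matrix (Fin n) (Fin n) ℂ).mulVec lam) := by
    intro γ δ h
    have h1 : (ρ (γ⁻¹ * δ) : Matrix (Fin n) (Fin n) ℂ).mulVec lam = lam := by
      rw [map_mul]
      change ((ρ γ⁻¹ : Matrix (Fin n) (Fin n) ℂ) * (ρ δ : Matrix (Fin n) (Fin n) ℂ)).mulVec lam = lam
      rw [← mulVec_mulVec]
      simp only at h
      rw [← h, mulVec_mulVec, hinv, one_mulVec]
    exact inv_mul_eq_one.1 (hfree _ lam hl h1)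
  have horth : ∀ γ δ : Γ,
        dotProduct (star ((phi γ).mulVec v)) ((phi δ).mulVec v) =
          if γ = δ then 1 else 0 := by
    intro γ δ
    split_ifs with h
    · subst h; rw [phi_norm, hv1]
    · exact jeig_orth n α hmom _ _ _ _ (hE γ) (hE δ) (fun e => h (hinj e))
  refine ⟨v, lam, hl, horth, ?_, hE, hinj, ?_⟩
  · have hli : LinearIndependent ℂ (fun γ : Γ => (phi γ).mulVec v) := by
      rw [Fintype.linearIndependent_iff]
      intro g hg γ
      have := congrArg (fun x => star ((phi γ).mulVec v) ⬝ᵥ x) hg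
      simpa [dotProduct_sum, dotProduct_smul, horth] using this
    exact hli.span_eq_top_of_card_eq_finrank' (by simp)
  · intro γ h
    apply hl
    rw [← one_mulVec lam, ← hinv γ, ← mulVec_mulVec, h, mulVec_zero]
end

section
/- Assume ρ acts freely outside the origin. Let α = (α₁, …, αₙ) be a Γ-equivariant, commuting n-tuple of endomorphisms of ℂ^Γ satisfying the zero-moment condition, with α ≠ 0. If T is a unitary operator on ℂ^Γ such that Tφ(γ) = φ(γ)T for all γ ∈ Γ and Tαᵢ = αᵢT for all i, then T is a scalar: T = c·Id for some c ∈ ℂ with |c| = 1. -/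
open Matrix

variable {Γ : Type} [Group Γ] [Fintype Γ] [DecidableEq Γ]

theorem aux_joint_s5 (n : ℕ) (α : Fin n → Matrix Γ Γ ℂ) (hcomm : CommutingTuple n α)
    (U : Submodule ℂ (Γ → ℂ)) (hU : U ≠ ⊥) (hinv : ∀ i, ∀ x ∈ U, α i *ᵥ x ∈ U) :
    ∃ u ∈ U, u ≠ 0 ∧ ∃ lam : Fin n → ℂ, ∀ i, α i *ᵥ u = lam i • u := by
  have key : ∀ s : Finset (Fin n), ∃ U' : Submodule ℂ (Γ → ℂ), U' ≤ U ∧ U' ≠ ⊥ ∧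
      (∀ i, ∀ x ∈ U', α i *ᵥ x ∈ U') ∧ ∀ i ∈ s, ∃ c : ℂ, ∀ x ∈ U', α i *ᵥ x = c • x := by
    intro s
    induction s using Finset.induction_on with
    | empty => exact ⟨U, le_rfl, hU, hinv, by simp⟩
    | insert a s _ ih =>
      obtain ⟨U', hle, hne, hi, hs⟩ := ih
      haveI : Nontrivial U' := Submodule.nontrivial_iff_ne_bot.mpr hne
      obtain ⟨c, hc⟩ := Module.End.exists_eigenvalue
        (((α a).mulVecLin).restrict (p := U') (q := U') (fun x hx => hi a x hx))
      obtain ⟨w, hw⟩ := hc.exists_hasEigenvector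
      have hw1 : α a *ᵥ (w : Γ → ℂ) = c • (w : Γ → ℂ) := by
        have := congrArg Subtype.val hw.apply_eq_smul
        exact this
      refine ⟨U' ⊓ Module.End.eigenspace ((α a).mulVecLin) c, inf_le_left.trans hle, ?_, ?_, ?_⟩
      · rw [Submodule.ne_bot_iff]
        refine ⟨w, ⟨w.2, ?_⟩, fun h => hw.2 (Subtype.ext h)⟩
        rw [SetLike.mem_coe, Module.End.mem_eigenspace_iff]
        exact hw1
      · rintro i x ⟨hx1, hx2⟩
        rw [SetLike.mem_coe, Module.End.mem_eigenspace_iff] at hx2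
        refine ⟨hi i x hx1, ?_⟩
        rw [SetLike.mem_coe, Module.End.mem_eigenspace_iff]
        simp only [mulVecLin_apply] at hx2 ⊢
        rw [mulVec_mulVec, hcomm, ← mulVec_mulVec, hx2, mulVec_smul]
      · intro i his
        rcases Finset.mem_insert.mp his with rfl | his
        · refine ⟨c, fun x hx => ?_⟩
          have := hx.2
          rw [SetLike.mem_coe, Module.End.mem_eigenspace_iff] at this
          exact this
        · obtain ⟨d, hd⟩ := hs i his
          exact ⟨d, fun x hx => hd x hx.1⟩
  obtain ⟨U', hle, hne, _, hs⟩ := key Finset.univ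
  obtain ⟨u, hu, hu0⟩ := (Submodule.ne_bot_iff _).mp hne
  choose lam hlam using fun i => hs i (Finset.mem_univ i)
  exact ⟨u, hle hu, hu0, lam, fun i => hlam i u hu⟩

theorem aux_kernel (n : ℕ) (α : Fin n → Matrix Γ Γ ℂ) (hmom : ZeroMoment n α)
    (u : Γ → ℂ) (hu : ∀ i, α i *ᵥ u = 0) (i : Fin n) : (α i)ᴴ *ᵥ u = 0 := by
  have h : star u ⬝ᵥ ((∑ i, ((α i)ᴴ * α i - α i * (α i)ᴴ)) *ᵥ u) = 0 := by
    rw [show (∑ i, ((α i)ᴴ * α i - α i * (α i)ᴴ)) = 0 from hmom]; simp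
  have h2 : ∑ i, star ((α i)ᴴ *ᵥ u) ⬝ᵥ ((α i)ᴴ *ᵥ u) = 0 := by
    rw [sum_mulVec, dotProduct_sum] at h
    rw [← neg_eq_zero, ← Finset.sum_neg_distrib, ← h]
    refine Finset.sum_congr rfl fun i _ => ?_
    rw [sub_mulVec, ← mulVec_mulVec, hu i, mulVec_zero, zero_sub, dotProduct_neg,
      ← mulVec_mulVec, star_mulVec, conjTranspose_conjTranspose, dotProduct_mulVec,
      dotProduct_mulVec, dotProduct_mulVec]
  open scoped ComplexOrder in
  have h3 := (Finset.sum_eq_zero_iff_of_nonneg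
    (fun i _ => dotProduct_star_self_nonneg ((α i)ᴴ *ᵥ u))).mp h2 i (Finset.mem_univ i)
  open scoped ComplexOrder in
  exact dotProduct_star_self_eq_zero.mp h3

theorem aux_vec (n : ℕ) (α : Fin n → Matrix Γ Γ ℂ) (hcomm : CommutingTuple n α)
    (hmom : ZeroMoment n α) (hne : ∃ i, α i ≠ 0) :
    ∃ u : Γ → ℂ, u ≠ 0 ∧ ∃ lam : Fin n → ℂ, lam ≠ 0 ∧ ∀ i, α i *ᵥ u = lam i • u := by
  set U : Submodule ℂ (Γ → ℂ) := ⨆ i, LinearMap.range (α i).mulVecLin with hUdef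
  have hmem : ∀ i x, α i *ᵥ x ∈ U := fun i x =>
    (le_iSup (fun i => LinearMap.range (α i).mulVecLin) i) ⟨x, rfl⟩
  have hU : U ≠ ⊥ := by
    intro h
    obtain ⟨i, hi⟩ := hne
    apply hi
    apply Matrix.ext_of_mulVec_single
    intro j
    have := hmem i (Pi.single j 1)
    rw [h, Submodule.mem_bot] at this
    rw [this, zero_mulVec]
  obtain ⟨u, huU, hu0, lam, hlam⟩ := aux_joint_s5 n α hcomm U hU (fun i x _ => hmem i x)
  refine ⟨u, hu0, lam, ?_, hlam⟩
  rintro rfl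
  have hk := aux_kernel n α hmom u (fun i => by simpa using hlam i)
  have hperp : ∀ x ∈ U, star u ⬝ᵥ x = 0 := by
    intro x hx
    refine Submodule.iSup_induction (fun i => LinearMap.range (α i).mulVecLin)
      (motive := fun x => star u ⬝ᵥ x = 0) hx ?_ (by simp) ?_
    · rintro i _ ⟨y, rfl⟩
      have := congrArg star (hk i)
      rw [star_mulVec, conjTranspose_conjTranspose, star_zero] at this
      rw [mulVecLin_apply, dotProduct_mulVec, this, zero_dotProduct]
    · intro x y hx hy
      rw [dotProduct_add, hx, hy, add_zero]
  open scoped ComplexOrder in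
  exact hu0 (dotProduct_star_self_eq_zero.mp (hperp u huU))

theorem aux_phi_mul (a b : Γ) : phi a * phi b = phi (a * b) := by
  ext i j
  simp [phi, Matrix.mul_apply, mul_assoc]

theorem aux_phi_one : phi (1 : Γ) = 1 := by
  ext i j
  simp [phi, Matrix.one_apply]

/-- If `ρ` acts freely outside the origin and `α` is a nonzero `Γ`-equivariant, commuting,
zero-moment `n`-tuple, then any unitary operator on `ℂ^Γ` commuting with all `φ(γ)` and with
all `αᵢ` is a scalar of modulus one. -/
theorem stabiliser_trivial (n : ℕ) (ρ : Γ →* Matrix.unitaryGroup (Fin n) ℂ)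
    (hfree : FreeOutside n ρ)
    (α : Fin n → Matrix Γ Γ ℂ)
    (hequiv : Equivariant n ρ α) (hcomm : CommutingTuple n α) (hmom : ZeroMoment n α)
    (hne : ∃ i, α i ≠ 0)
    (T : Matrix Γ Γ ℂ) (hT : T ∈ Matrix.unitaryGroup Γ ℂ)
    (hTphi : ∀ γ : Γ, T * phi γ = phi γ * T)
    (hTα : ∀ i, T * α i = α i * T) :
    ∃ c : ℂ, ‖c‖ = 1 ∧ T = c • (1 : Matrix Γ Γ ℂ) := by
  classical
  obtain ⟨u, hu0, lam, hlam0, hu⟩ := aux_vec n α hcomm hmom hne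
  set w : Γ → (Γ → ℂ) := fun γ => phi γ *ᵥ u with hw
  set χ : Γ → (Fin n → ℂ) := fun γ => (ρ γ : Matrix (Fin n) (Fin n) ℂ) *ᵥ lam with hχ
  have hχ1 : χ 1 = lam := by simp [hχ]
  have hw1 : w 1 = u := by simp [hw, aux_phi_one]
  have hweig : ∀ γ k, α k *ᵥ w γ = χ γ k • w γ := by
    intro γ k
    have h1 : α k * phi γ = phi γ * ∑ l, ((ρ γ : Matrix (Fin n) (Fin n) ℂ) k l) • α l := by
      rw [← hequiv γ k, ← mul_assoc, ← mul_assoc, aux_phi_mul, mul_inv_cancel, aux_phi_one,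
        one_mul]
    simp only [hw]
    rw [mulVec_mulVec, h1, ← mulVec_mulVec, sum_mulVec]
    simp only [smul_mulVec, hu, smul_smul]
    rw [← Finset.sum_smul, mulVec_smul]
    rfl
  have hχinj : Function.Injective χ := by
    intro a b hab
    have : ((ρ (b⁻¹ * a) : Matrix.unitaryGroup (Fin n) ℂ) : Matrix (Fin n) (Fin n) ℂ) *ᵥ lam
        = lam := by
      have h2 := congrArg
        (fun v => ((ρ b⁻¹ : Matrix.unitaryGroup (Fin n) ℂ) : Matrix (Fin n) (Fin n) ℂ) *ᵥ v) hab
      simp only [hχ, mulVec_mulVec] at h2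
      rw [← Submonoid.coe_mul, ← Submonoid.coe_mul, ← map_mul, ← map_mul, inv_mul_cancel] at h2
      rw [h2]; simp
    have := hfree _ lam hlam0 this
    exact (inv_mul_eq_one.mp this).symm
  have hw0 : ∀ γ, w γ ≠ 0 := by
    intro γ h
    apply hu0
    have h2 := congrArg (fun v => phi γ⁻¹ *ᵥ v) h
    simpa [hw, mulVec_mulVec, aux_phi_mul, aux_phi_one] using h2
  have hind := Module.End.independent_iInf_maxGenEigenspace_of_forall_mapsTo
    (fun i => (α i).mulVecLin) (fun i j c => Module.End.mapsTo_maxGenEigenspace_of_comm (by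
      change (α j).mulVecLin * (α i).mulVecLin = (α i).mulVecLin * (α j).mulVecLin
      rw [Module.End.mul_eq_comp, Module.End.mul_eq_comp, ← mulVecLin_mul, ← mulVecLin_mul,
        hcomm]) c)
  have hli : LinearIndependent ℂ w := by
    refine iSupIndep.linearIndependent _ (hind.comp hχinj) (fun γ => ?_) hw0
    simp only [Function.comp, Submodule.mem_iInf]
    intro i
    apply Module.End.eigenspace_le_maxGenEigenspace
    rw [Module.End.mem_eigenspace_iff]
    exact hweig γ i
  let B := basisOfLinearIndependentOfCardEqFinrank hli (by simp)
  have hB : ∀ γ, B γ = w γ := fun γ => by simp [B]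
  have hTu : ∃ c : ℂ, T *ᵥ u = c • u := by
    refine ⟨B.repr (T *ᵥ u) 1, ?_⟩
    have hz : ∀ γ, γ ≠ 1 → B.repr (T *ᵥ u) γ = 0 := by
      intro γ hγ
      have hne' : χ γ ≠ lam := fun h => hγ (hχinj (h.trans hχ1.symm))
      obtain ⟨k, hk⟩ := Function.ne_iff.mp hne'
      have hsum := B.sum_repr (T *ᵥ u)
      have e1 : α k *ᵥ (T *ᵥ u) = lam k • (T *ᵥ u) := by
        rw [mulVec_mulVec, ← hTα, ← mulVec_mulVec, hu, mulVec_smul]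
      have e2 : ∑ δ, (B.repr (T *ᵥ u) δ * (χ δ k - lam k)) • w δ = 0 := by
        have e3 : α k *ᵥ (∑ δ, B.repr (T *ᵥ u) δ • B δ)
            = lam k • (∑ δ, B.repr (T *ᵥ u) δ • B δ) := by
          rw [hsum, e1]
        rw [mulVec_sum, Finset.smul_sum, ← sub_eq_zero, ← Finset.sum_sub_distrib] at e3
        rw [← e3]
        refine Finset.sum_congr rfl fun δ _ => ?_
        rw [hB, mulVec_smul, hweig, smul_smul, smul_smul, ← sub_smul]
        congr 1; ring
      have := Fintype.linearIndependent_iff.mp hli _ e2 γ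
      exact (mul_eq_zero.mp this).resolve_right (sub_ne_zero.mpr hk)
    conv_lhs => rw [← B.sum_repr (T *ᵥ u)]
    rw [Finset.sum_eq_single 1 (fun γ _ h => by rw [hz γ h, zero_smul]) (by simp), hB, hw1]
  obtain ⟨c, hc⟩ := hTu
  have hTc : T = c • (1 : Matrix Γ Γ ℂ) := by
    have : T.mulVecLin = (c • (1 : Matrix Γ Γ ℂ)).mulVecLin := by
      refine B.ext fun γ => ?_
      rw [hB, mulVecLin_apply, mulVecLin_apply, smul_mulVec, one_mulVec]
      simp only [hw]
      rw [mulVec_mulVec, hTphi, ← mulVec_mulVec, hc, mulVec_smul]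
    exact Matrix.ext_of_mulVec_single fun i => LinearMap.congr_fun this _
  refine ⟨c, ?_, hTc⟩
  have h1 := Matrix.mem_unitaryGroup_iff.mp hT
  rw [hTc] at h1
  have h2 := congrFun (congrFun h1 1) 1
  simp [Matrix.star_eq_conjTranspose] at h2
  have h3 : ‖c‖ * ‖c‖ = 1 := by
    have := congrArg norm h2
    simpa using this
  nlinarith [norm_nonneg c]
end

section
/- Let α = (α₁, α₂, α₃) be a triple of r×r complex matrices with [αᵢ, αⱼ] = 0 for all i, j. Let V₂ be the complex vector space of families G = (G_{jk})_{1≤j,k≤3} of r×r matrices with G_{jk} = −G_{kj}, with inner product ⟨G, H⟩ := Σ_{j<k} tr(G_{jk} H_{jk}*). Define d¹: Mat_r(ℂ)³ → V₂ by (d¹ε)_{jk} := [αⱼ, εₖ] − [αₖ, εⱼ] and d²: V₂ → Mat_r(ℂ) by d²(G) := Σ_{i,j,k=1}^3 ε_{ijk} [αᵢ, G_{jk}]. Then the image of d¹ is contained in the kernel of d²; and if P denotes the orthogonal projection of V₂ onto H² := ker d² ∩ (Im d¹)^⊥, then for every η = (η₁, η₂, η₃) with [αᵢ, ηⱼ]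 = [αⱼ, ηᵢ] for all i, j, and every G ∈ ker d², one has Σ_{i,j,k=1}^3 ε_{ijk} tr(ηᵢ (PG)_{jk}) = Σ_{i,j,k=1}^3 ε_{ijk} tr(ηᵢ G_{jk}). (That is, the trace pairing of a closed degree-one element with a closed degree-two element is unchanged by harmonic projection.) -/
open Matrix

/-- The commutator `[A, B] = AB − BA` of two matrices. -/
noncomputable def brkt {r : ℕ} (A B : Matrix (Fin r) (Fin r) ℂ) : Matrix (Fin r) (Fin r) ℂ :=
  A * B - B * A

/-- The Levi-Civita symbol on `{0, 1, 2}`: the sign of the permutation `(i, j, k)`, and zero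
if two indices coincide. -/
def lc (i j k : Fin 3) : ℤ :=
  (((j : ℕ) : ℤ) - ((i : ℕ) : ℤ)) * (((k : ℕ) : ℤ) - ((i : ℕ) : ℤ)) *
    (((k : ℕ) : ℤ) - ((j : ℕ) : ℤ)) / 2

/-- A family `G = (G_{jk})` of matrices is skew if `G_{jk} = −G_{kj}`. -/
def Skew {r : ℕ} (G : Fin 3 → Fin 3 → Matrix (Fin r) (Fin r) ℂ) : Prop :=
  ∀ j k, G j k = - G k j

/-- The first differential: `(d¹ε)_{jk} = [αⱼ, εₖ] − [αₖ, εⱼ]`. -/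
noncomputable def d1 {r : ℕ} (α : Fin 3 → Matrix (Fin r) (Fin r) ℂ)
    (e : Fin 3 → Matrix (Fin r) (Fin r) ℂ) : Fin 3 → Fin 3 → Matrix (Fin r) (Fin r) ℂ :=
  fun j k => brkt (α j) (e k) - brkt (α k) (e j)

/-- The second differential: `d²(G) = ∑ ijk, ε_{ijk} [αᵢ, G_{jk}]`. -/
noncomputable def d2 {r : ℕ} (α : Fin 3 → Matrix (Fin r) (Fin r) ℂ)
    (G : Fin 3 → Fin 3 → Matrix (Fin r) (Fin r) ℂ) : Matrix (Fin r) (Fin r) ℂ :=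
  ∑ i, ∑ j, ∑ k, ((lc i j k : ℤ) : ℂ) • brkt (α i) (G j k)

/-- The Hermitian inner product `⟨G, H⟩ = ∑_{j<k} tr (G_{jk} H_{jk}*)` on skew families. -/
noncomputable def ip {r : ℕ} (G H : Fin 3 → Fin 3 → Matrix (Fin r) (Fin r) ℂ) : ℂ :=
  ∑ j : Fin 3, ∑ k : Fin 3, if (j : ℕ) < (k : ℕ) then Matrix.trace (G j k * (H j k)ᴴ) else 0

/-- The pairing `∑ ijk, ε_{ijk} tr (ηᵢ G_{jk})` of a degree-one element with a degree-two
element. -/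
noncomputable def pairing {r : ℕ} (η : Fin 3 → Matrix (Fin r) (Fin r) ℂ)
    (G : Fin 3 → Fin 3 → Matrix (Fin r) (Fin r) ℂ) : ℂ :=
  ∑ i, ∑ j, ∑ k, ((lc i j k : ℤ) : ℂ) * Matrix.trace (η i * G j k)

/-- Membership in the harmonic space `H² = ker d² ∩ (Im d¹)^⊥` (within skew families). -/
noncomputable def MemH2 {r : ℕ} (α : Fin 3 → Matrix (Fin r) (Fin r) ℂ)
    (H : Fin 3 → Fin 3 → Matrix (Fin r) (Fin r) ℂ) : Prop :=
  Skew H ∧ d2 α H = 0 ∧ ∀ e : Fin 3 → Matrix (Fin r) (Fin r) ℂ, ip (d1 α e) H = 0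

lemma d2_expand {r : ℕ} (α : Fin 3 → Matrix (Fin r) (Fin r) ℂ)
    (G : Fin 3 → Fin 3 → Matrix (Fin r) (Fin r) ℂ) :
    d2 α G = brkt (α 0) (G 1 2) - brkt (α 0) (G 2 1) + brkt (α 1) (G 2 0) - brkt (α 1) (G 0 2)
      + brkt (α 2) (G 0 1) - brkt (α 2) (G 1 0) := by
  norm_num [d2, Fin.sum_univ_three, lc]
  abel

lemma pairing_expand {r : ℕ} (η : Fin 3 → Matrix (Fin r) (Fin r) ℂ)
    (G : Fin 3 → Fin 3 → Matrix (Fin r) (Fin r) ℂ) :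
    pairing η G = trace (η 0 * G 1 2) - trace (η 0 * G 2 1) + trace (η 1 * G 2 0)
      - trace (η 1 * G 0 2) + trace (η 2 * G 0 1) - trace (η 2 * G 1 0) := by
  simp [pairing, Fin.sum_univ_three, lc]
  ring

lemma ip_expand {r : ℕ} (G H : Fin 3 → Fin 3 → Matrix (Fin r) (Fin r) ℂ) :
    ip G H = trace (G 0 1 * (H 0 1)ᴴ) + trace (G 0 2 * (H 0 2)ᴴ) + trace (G 1 2 * (H 1 2)ᴴ) := by
  simp [ip, Fin.sum_univ_three]

lemma d2_d1 {r : ℕ} (α : Fin 3 → Matrix (Fin r) (Fin r) ℂ)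
    (hcomm : ∀ i j, brkt (α i) (α j) = 0) (e : Fin 3 → Matrix (Fin r) (Fin r) ℂ) :
    d2 α (d1 α e) = 0 := by
  have hc : ∀ i j, α i * α j = α j * α i := fun i j => sub_eq_zero.mp (hcomm i j)
  have key : ∀ i j k, brkt (α i) (brkt (α j) (e k)) = brkt (α j) (brkt (α i) (e k)) := by
    intro i j k
    have h1 := congrArg (· * e k) (hc i j)
    have h2 := congrArg (e k * ·) (hc i j)
    simp only [brkt, mul_sub, sub_mul, mul_assoc] at h1 h2 ⊢
    rw [h1, h2]; abel
  have hs : ∀ A B C : Matrix (Fin r) (Fin r) ℂ, brkt A (B - C) = brkt A B - brkt A C := by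
    intro A B C; simp only [brkt, mul_sub, sub_mul]; abel
  rw [d2_expand]
  simp only [d1, hs]
  rw [key 1 0, key 2 0, key 2 1]
  abel

lemma pairing_d1 {r : ℕ} (α η e : Fin 3 → Matrix (Fin r) (Fin r) ℂ)
    (h : ∀ i j, brkt (α i) (η j) = brkt (α j) (η i)) :
    pairing η (d1 α e) = 0 := by
  have key : ∀ i j k, trace (η i * brkt (α j) (e k)) = trace (η j * brkt (α i) (e k)) := by
    intro i j k
    have h1 : ∀ A B C : Matrix (Fin r) (Fin r) ℂ,
        trace (A * brkt B C) = - trace (brkt B A * C) := by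
      intro A B C
      simp only [brkt, mul_sub, sub_mul, trace_sub]
      rw [← mul_assoc A C B, trace_mul_comm (A * C) B, mul_assoc, mul_assoc]
      ring
    rw [h1, h1, h j i]
  rw [pairing_expand]
  simp only [d1, mul_sub, trace_sub]
  rw [key 1 0, key 2 0, key 2 1]
  ring

/-- Flatten a family into a Euclidean vector. -/
noncomputable def flat {r : ℕ} : (Fin 3 → Fin 3 → Matrix (Fin r) (Fin r) ℂ) →ₗ[ℂ]
    EuclideanSpace ℂ (Fin 3 × Fin 3 × Fin r × Fin r) where
  toFun G := WithLp.toLp 2 (fun p => G p.1 p.2.1 p.2.2.1 p.2.2.2)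
  map_add' _ _ := rfl
  map_smul' _ _ := rfl

/-- The first differential as a linear map. -/
noncomputable def d1L {r : ℕ} (α : Fin 3 → Matrix (Fin r) (Fin r) ℂ) :
    (Fin 3 → Matrix (Fin r) (Fin r) ℂ) →ₗ[ℂ] (Fin 3 → Fin 3 → Matrix (Fin r) (Fin r) ℂ) where
  toFun e := d1 α e
  map_add' e f := by
    funext j k; simp only [d1, brkt, Pi.add_apply, mul_add, add_mul]; abel
  map_smul' c e := by
    funext j k
    simp only [d1, brkt, Pi.smul_apply, mul_smul_comm, smul_mul_assoc, smul_sub,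
      RingHom.id_apply]

lemma inner_flat {r : ℕ} (G H : Fin 3 → Fin 3 → Matrix (Fin r) (Fin r) ℂ)
    (hG : Skew G) (hH : Skew H) : inner ℂ (flat H) (flat G) = 2 * ip G H := by
  have h0 : ∀ j, G j j = 0 := by
    intro j
    ext a b
    have h := congrFun (congrFun (hG j j) a) b
    exact self_eq_neg.mp h
  have e1 : inner ℂ (flat H) (flat G) = ∑ j, ∑ k, trace (G j k * (H j k)ᴴ) := by
    simp [PiLp.inner_apply, flat, Fintype.sum_prod_type, trace, mul_apply]
    rfl
  rw [e1, ip_expand]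
  simp only [Fin.sum_univ_three, h0]
  rw [hG 1 0, hG 2 0, hG 2 1, hH 1 0, hH 2 0, hH 2 1]
  simp
  ring

lemma d1_skew {r : ℕ} (α e : Fin 3 → Matrix (Fin r) (Fin r) ℂ) : Skew (d1 α e) := by
  intro j k; simp [d1]

lemma exact_of {r : ℕ} (α : Fin 3 → Matrix (Fin r) (Fin r) ℂ)
    (hcomm : ∀ i j, brkt (α i) (α j) = 0) (K : Fin 3 → Fin 3 → Matrix (Fin r) (Fin r) ℂ)
    (hK : Skew K) (hK2 : d2 α K = 0) (hp : ∀ H, MemH2 α H → ip K H = 0) :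
    ∃ e, K = d1 α e := by
  obtain ⟨y, hy, z, hz, hyz⟩ :=
    (LinearMap.range (flat ∘ₗ d1L α)).exists_add_mem_mem_orthogonal (flat K)
  obtain ⟨e, rfl⟩ := hy
  have hzz : z = flat (K - d1 α e) := by
    rw [map_sub, hyz]; exact (add_sub_cancel_left _ _).symm
  set h := K - d1 α e with hh
  have hsk : Skew h := by
    intro j k
    simp only [hh, Pi.sub_apply]
    rw [hK j k, d1_skew α e j k]; abel
  have horth : ∀ f, ip (d1 α f) h = 0 := by
    intro f
    have := (Submodule.mem_orthogonal' _ _).mp hz (flat (d1 α f)) ⟨f, rfl⟩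
    rw [hzz, inner_flat _ _ (d1_skew α f) hsk] at this
    simpa using this
  have hd2 : d2 α h = 0 := by
    have : d2 α h = d2 α K - d2 α (d1 α e) := by
      simp only [d2_expand, hh, Pi.sub_apply, brkt, mul_sub, sub_mul]; abel
    rw [this, hK2, d2_d1 α hcomm, sub_zero]
  have hipK := hp h ⟨hsk, hd2, horth⟩
  have h0 : z = 0 := by
    have a : inner ℂ z (flat K) = 0 := by
      rw [hzz, inner_flat _ _ hK hsk, hipK, mul_zero]
    have b : inner ℂ z (flat (d1 α e)) = 0 :=
      (Submodule.mem_orthogonal' _ _).mp hz _ ⟨e, rfl⟩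
    have c : inner ℂ z z = 0 := by
      conv_lhs => rw [hzz]
      rw [map_sub, inner_sub_right, ← map_sub, ← hh, ← hzz, a, b, sub_zero]
    exact inner_self_eq_zero.mp c
  refine ⟨e, ?_⟩
  funext j k
  ext a b
  have := congrArg (fun v : EuclideanSpace ℂ (Fin 3 × Fin 3 × Fin r × Fin r) => v (j, k, a, b))
    (hzz.symm.trans h0)
  exact sub_eq_zero.mp this

/-- For a commuting triple `α`: the image of `d¹` is contained in the kernel of `d²`; and if
`P` is the orthogonal projection of the space of skew families onto `H² = ker d² ∩ (Im d¹)^⊥`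
(characterised by `P G ∈ H²` and `G − P G ⊥ H²`), then the pairing of any `∂̄_α`-closed
degree-one element `η` with any `G ∈ ker d²` is unchanged when `G` is replaced by its
harmonic projection `P G`. -/
theorem pairing_invariant_under_harmonic_projection (r : ℕ)
    (α : Fin 3 → Matrix (Fin r) (Fin r) ℂ)
    (hcomm : ∀ i j, brkt (α i) (α j) = 0)
    (P : (Fin 3 → Fin 3 → Matrix (Fin r) (Fin r) ℂ) →
         (Fin 3 → Fin 3 → Matrix (Fin r) (Fin r) ℂ))
    (hP : ∀ G, Skew G →
      MemH2 α (P G) ∧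
      ∀ H, MemH2 α H → ip (fun j k => G j k - P G j k) H = 0) :
    (∀ e : Fin 3 → Matrix (Fin r) (Fin r) ℂ, d2 α (d1 α e) = 0) ∧
    ∀ η : Fin 3 → Matrix (Fin r) (Fin r) ℂ,
      (∀ i j, brkt (α i) (η j) = brkt (α j) (η i)) →
      ∀ G, Skew G → d2 α G = 0 → pairing η (P G) = pairing η G := by
  refine ⟨d2_d1 α hcomm, ?_⟩
  intro η hη G hG hG2
  obtain ⟨⟨hs, hd, ho⟩, hperp⟩ := hP G hG
  have hK : Skew (fun j k => G j k - P G j k) := by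
    intro j k
    show G j k - P G j k = -(G k j - P G k j)
    rw [hG j k, hs j k]; abel
  have hK2 : d2 α (fun j k => G j k - P G j k) = 0 := by
    have : d2 α (fun j k => G j k - P G j k) = d2 α G - d2 α (P G) := by
      simp only [d2_expand, brkt, mul_sub, sub_mul]; abel
    rw [this, hG2, hd, sub_zero]
  obtain ⟨e, he⟩ := exact_of α hcomm _ hK hK2 hperp
  have h1 : pairing η (fun j k => G j k - P G j k) = pairing η G - pairing η (P G) := by
    simp only [pairing_expand, mul_sub, trace_sub]; ring
  rw [he, pairing_d1 α η e hη] at h1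
  exact (sub_eq_zero.mp h1.symm).symm
end
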